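/- Let X be the ℂ-subalgebra of Maps(SL(2,ℂ)^4, ℂ) generated by the fifteen trace functions t_{i1⋯ir} for 1 ≤ i1 < ⋯ < ir ≤ 4 (this subalgebra is the coordinate ring of the SL(2,ℂ)-character variety of the rank 4 free group F4), and let Q be the ℂ-subalgebra generated by t1, t2, t3, t4, t12, t23, t34, t14. Then X, regarded as a Q-module, is free with basis A = {1, t13, t24, t13·t24} ∪ {t13^k, t13^k·t24, t24^k, t24^k·t13 : k ≥ 2} ∪ {t13^k·t123, t13^k·t134, t24^k·t124, t24^k·t234 : k ≥ 0}. -/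

import Mathlib

/-- The 2×2 complex matrices. -/
abbrev M2 : Type := Matrix (Fin 2) (Fin 2) ℂ

/-- The group SL(2,ℂ). -/
abbrev SL2 : Type := Matrix.SpecialLinearGroup (Fin 2) ℂ

/-- The trace function `t_i` on quadruples in SL(2,ℂ): `ρ ↦ tr(ρ_i)`.
(Indices are 0-based: `tr1 0` is `t₁`, ..., `tr1 3` is `t₄`.) -/
noncomputable def tr1 (i : Fin 4) : (Fin 4 → SL2) → ℂ :=
  fun ρ => Matrix.trace (ρ i : M2)

/-- The trace function `t_{ij}` on quadruples in SL(2,ℂ): `ρ ↦ tr(ρ_i·ρ_j)`. -/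
noncomputable def tr2 (i j : Fin 4) : (Fin 4 → SL2) → ℂ :=
  fun ρ => Matrix.trace ((ρ i : M2) * (ρ j : M2))

/-- The trace function `t_{ijk}` on quadruples in SL(2,ℂ): `ρ ↦ tr(ρ_i·ρ_j·ρ_k)`. -/
noncomputable def tr3 (i j k : Fin 4) : (Fin 4 → SL2) → ℂ :=
  fun ρ => Matrix.trace ((ρ i : M2) * (ρ j : M2) * (ρ k : M2))

/-- The trace function `t₁₂₃₄` on quadruples in SL(2,ℂ): `ρ ↦ tr(ρ₁·ρ₂·ρ₃·ρ₄)`. -/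
noncomputable def tr4 : (Fin 4 → SL2) → ℂ :=
  fun ρ => Matrix.trace ((ρ 0 : M2) * (ρ 1 : M2) * (ρ 2 : M2) * (ρ 3 : M2))

/-- The ℂ-subalgebra `X` of functions SL(2,ℂ)⁴ → ℂ generated by the fifteen trace
functions `t_{i₁⋯i_r}`, `1 ≤ i₁ < ⋯ < i_r ≤ 4`; it is the coordinate ring of the
SL(2,ℂ)-character variety of the rank 4 free group. -/
noncomputable def Xalg : Subalgebra ℂ ((Fin 4 → SL2) → ℂ) :=
  Algebra.adjoin ℂ
    {f | (∃ i, f = tr1 i) ∨ (∃ i j, i < j ∧ f = tr2 i j) ∨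
      (∃ i j k, i < j ∧ j < k ∧ f = tr3 i j k) ∨ f = tr4}

/-- The ℂ-subalgebra `Q` generated by t₁, t₂, t₃, t₄, t₁₂, t₂₃, t₃₄, t₁₄. -/
noncomputable def Qalg : Subalgebra ℂ ((Fin 4 → SL2) → ℂ) :=
  Algebra.adjoin ℂ
    {tr1 0, tr1 1, tr1 2, tr1 3, tr2 0 1, tr2 1 2, tr2 2 3, tr2 0 3}

/-- The set `A = {1, t₁₃, t₂₄, t₁₃t₂₄} ∪ {t₁₃ᵏ, t₁₃ᵏt₂₄, t₂₄ᵏ, t₂₄ᵏt₁₃ : k ≥ 2}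
∪ {t₁₃ᵏt₁₂₃, t₁₃ᵏt₁₃₄, t₂₄ᵏt₁₂₄, t₂₄ᵏt₂₃₄ : k ≥ 0}`. -/
noncomputable def Aset : Set ((Fin 4 → SL2) → ℂ) :=
  {1, tr2 0 2, tr2 1 3, tr2 0 2 * tr2 1 3} ∪
  {f | ∃ k : ℕ, 2 ≤ k ∧ (f = tr2 0 2 ^ k ∨ f = tr2 0 2 ^ k * tr2 1 3 ∨
    f = tr2 1 3 ^ k ∨ f = tr2 1 3 ^ k * tr2 0 2)} ∪
  {f | ∃ k : ℕ, f = tr2 0 2 ^ k * tr3 0 1 2 ∨ f = tr2 0 2 ^ k * tr3 0 2 3 ∨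
    f = tr2 1 3 ^ k * tr3 0 1 3 ∨ f = tr2 1 3 ^ k * tr3 1 2 3}

/-- Functions on quadruples. -/
abbrev Fn : Type := (Fin 4 → SL2) → ℂ

/-- The Gram form on traceless parts. -/
noncomputable def bf (i j : Fin 4) : Fn := tr2 i j - (1 / 2 : ℂ) • (tr1 i * tr1 j)

/-- The odd part of the triple trace. -/
noncomputable def sf (i j k : Fin 4) : Fn := (1 / 2 : ℂ) • (tr3 i j k - tr3 k j i)

/-- coordinate of traceless part -/
noncomputable def zc (ρ : Fin 4 → SL2) (i : Fin 4) : ℂ := ((ρ i : M2) 0 0 - (ρ i : M2) 1 1) / 2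

/-- coordinate of traceless part -/
noncomputable def pc (ρ : Fin 4 → SL2) (i : Fin 4) : ℂ := (ρ i : M2) 0 1

/-- coordinate of traceless part -/
noncomputable def qc (ρ : Fin 4 → SL2) (i : Fin 4) : ℂ := (ρ i : M2) 1 0

lemma tr1_apply (ρ : Fin 4 → SL2) (i : Fin 4) :
    tr1 i ρ = (ρ i : M2) 0 0 + (ρ i : M2) 1 1 := by
  simp [tr1, Matrix.trace, Fin.sum_univ_two]

lemma bf_apply (ρ : Fin 4 → SL2) (i j : Fin 4) :
    bf i j ρ = 2 * zc ρ i * zc ρ j + pc ρ i * qc ρ j + qc ρ i * pc ρ j := by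
  simp [bf, tr1, tr2, zc, pc, qc, Matrix.trace, Fin.sum_univ_two, Matrix.mul_apply]
  ring

lemma sf_apply (ρ : Fin 4 → SL2) (i j k : Fin 4) :
    sf i j k ρ = zc ρ k * (pc ρ i * qc ρ j - qc ρ i * pc ρ j)
      + zc ρ i * (pc ρ j * qc ρ k - qc ρ j * pc ρ k)
      - zc ρ j * (pc ρ i * qc ρ k - qc ρ i * pc ρ k) := by
  simp [sf, tr3, zc, pc, qc, Matrix.trace, Fin.sum_univ_two, Matrix.mul_apply]
  ring

lemma bf_diag (i : Fin 4) : bf i i = (1 / 2 : ℂ) • (tr1 i * tr1 i) - algebraMap ℂ Fn 2 := by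
  funext ρ
  have h := (ρ i).det_coe
  rw [Matrix.det_fin_two] at h
  simp [bf, tr1, tr2, Matrix.trace, Fin.sum_univ_two, Matrix.mul_apply]
  linear_combination (-2) * h

lemma bf_symm (i j : Fin 4) : bf i j = bf j i := by
  funext ρ
  rw [bf_apply, bf_apply]; ring

lemma tr3_eq (i j k : Fin 4) : tr3 i j k = sf i j k + (1 / 2 : ℂ) •
    (tr1 i * tr2 j k + tr1 j * tr2 i k + tr1 k * tr2 i j - tr1 i * tr1 j * tr1 k) := by
  funext ρ
  simp [sf, tr1, tr2, tr3, Matrix.trace, Fin.sum_univ_two, Matrix.mul_apply]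
  ring

lemma tr4_eq : tr4 = (1 / 2 : ℂ) • (tr1 0 * tr1 1 * tr1 2 * tr1 3 + tr1 0 * tr3 1 2 3
    + tr1 1 * tr3 0 2 3 + tr1 2 * tr3 0 1 3 + tr1 3 * tr3 0 1 2 + tr2 0 1 * tr2 2 3
    + tr2 0 3 * tr2 1 2 - tr2 0 2 * tr2 1 3 - tr1 0 * tr1 1 * tr2 2 3
    - tr1 0 * tr1 3 * tr2 1 2 - tr1 1 * tr1 2 * tr2 0 3 - tr1 2 * tr1 3 * tr2 0 1) := by
  funext ρ
  simp [tr1, tr2, tr3, tr4, Matrix.trace, Fin.sum_univ_two, Matrix.mul_apply]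
  ring

/-- Gram minor of order three. -/
noncomputable def gm (i j k l m n : Fin 4) : Fn :=
  bf i l * (bf j m * bf k n - bf j n * bf k m) - bf i m * (bf j l * bf k n - bf j n * bf k l)
    + bf i n * (bf j l * bf k m - bf j m * bf k l)

lemma sf_mul (i j k l m n : Fin 4) :
    sf i j k * sf l m n = (-1 / 2 : ℂ) • gm i j k l m n := by
  funext ρ
  simp only [gm, Pi.mul_apply, Pi.smul_apply, Pi.sub_apply, Pi.add_apply, bf_apply, sf_apply,
    smul_eq_mul]
  ring

lemma sf_rel (m : Fin 4) : bf m 0 * sf 1 2 3 - bf m 1 * sf 0 2 3 + bf m 2 * sf 0 1 3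
    - bf m 3 * sf 0 1 2 = 0 := by
  funext ρ
  simp only [Pi.mul_apply, Pi.sub_apply, Pi.add_apply, bf_apply, sf_apply, Pi.zero_apply]
  ring

lemma gram4 : bf 0 2 ^ 2 * bf 1 3 ^ 2 = bf 1 1 * bf 3 3 * bf 0 2 ^ 2 + bf 0 0 * bf 2 2 * bf 1 3 ^ 2
    + 2 * (bf 0 1 * bf 2 3 + bf 0 3 * bf 1 2) * bf 0 2 * bf 1 3
    + (- 2 * bf 0 1 * bf 1 2 * bf 3 3 - 2 * bf 0 3 * bf 2 3 * bf 1 1) * bf 0 2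
    + (- 2 * bf 0 1 * bf 0 3 * bf 2 2 - 2 * bf 1 2 * bf 2 3 * bf 0 0) * bf 1 3
    + (- bf 0 0 * bf 1 1 * bf 2 2 * bf 3 3 + bf 0 0 * bf 1 1 * bf 2 3 ^ 2
      + bf 0 0 * bf 3 3 * bf 1 2 ^ 2 + bf 1 1 * bf 2 2 * bf 0 3 ^ 2 + bf 2 2 * bf 3 3 * bf 0 1 ^ 2
      - (bf 0 1 * bf 2 3 - bf 0 3 * bf 1 2) ^ 2 ) := by
  funext ρ
  simp only [Pi.mul_apply, Pi.sub_apply, Pi.add_apply, Pi.pow_apply, Pi.neg_apply, bf_apply,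
    Pi.ofNat_apply]
  ring

section Spanning

lemma even_closure {A : Type*} [CommRing A] (Q : Set A) (M : AddSubgroup A) (x y : A)
    (hQ : ∀ c ∈ Q, ∀ f ∈ M, c * f ∈ M)
    (hev : ∀ i j : ℕ, i < 2 ∨ j < 2 → x ^ i * y ^ j ∈ M)
    (hxy : ∃ c1 ∈ Q, ∃ c2 ∈ Q, ∃ c3 ∈ Q, ∃ c4 ∈ Q, ∃ c5 ∈ Q, ∃ c6 ∈ Q, ∃ c7 ∈ Q, ∃ c8 ∈ Q,
      x ^ 2 * y ^ 2 = c1 * (x ^ 2 * y) + c2 * x ^ 2 + c3 * (x * y ^ 2) + c4 * y ^ 2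
        + c5 * (x * y) + c6 * x + c7 * y + c8) (n : ℕ) :
    ∀ i j : ℕ, i + j = n → x ^ i * y ^ j ∈ M := by
  obtain ⟨c1, h1, c2, h2, c3, h3, c4, h4, c5, h5, c6, h6, c7, h7, c8, h8, h⟩ := hxy
  induction n using Nat.strong_induction_on with
  | _ n ih =>
    intro i j hij
    by_cases hc : i < 2 ∨ j < 2
    · exact hev i j hc
    · push Not at hc
      obtain ⟨i, rfl⟩ := Nat.exists_eq_add_of_le hc.1
      obtain ⟨j, rfl⟩ := Nat.exists_eq_add_of_le hc.2
      have e : x ^ (2 + i) * y ^ (2 + j) = c1 * (x ^ (2 + i) * y ^ (1 + j))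
          + c2 * (x ^ (2 + i) * y ^ j) + c3 * (x ^ (1 + i) * y ^ (2 + j))
          + c4 * (x ^ i * y ^ (2 + j)) + c5 * (x ^ (1 + i) * y ^ (1 + j))
          + c6 * (x ^ (1 + i) * y ^ j) + c7 * (x ^ i * y ^ (1 + j)) + c8 * (x ^ i * y ^ j) := by
        linear_combination (x ^ i * y ^ j) * h
      rw [e]
      have key : ∀ c ∈ Q, ∀ a b : ℕ, a + b < n → c * (x ^ a * y ^ b) ∈ M :=
        fun c hc a b hab => hQ c hc _ (ih (a + b) hab a b rfl)
      refine add_mem (add_mem (add_mem (add_mem (add_mem (add_mem (add_mem ?_ ?_) ?_) ?_) ?_) ?_)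
        ?_) ?_ <;> apply key <;> first | assumption | omega

lemma odd_closure {A : Type*} [CommRing A] (Q : Set A) (M : AddSubgroup A) (x y p q r u : A)
    (hQ : ∀ c ∈ Q, ∀ f ∈ M, c * f ∈ M)
    (hp : ∀ k : ℕ, x ^ k * p ∈ M) (hq : ∀ k : ℕ, x ^ k * q ∈ M)
    (hr : ∀ k : ℕ, y ^ k * r ∈ M) (hu : ∀ k : ℕ, y ^ k * u ∈ M)
    (hyp : ∃ c1 ∈ Q, ∃ c2 ∈ Q, ∃ c3 ∈ Q, ∃ c4 ∈ Q, y * p = c1 * p + c2 * q + c3 * r + c4 * u)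
    (hyq : ∃ c1 ∈ Q, ∃ c2 ∈ Q, ∃ c3 ∈ Q, ∃ c4 ∈ Q, y * q = c1 * p + c2 * q + c3 * r + c4 * u)
    (hxr : ∃ c1 ∈ Q, ∃ c2 ∈ Q, ∃ c3 ∈ Q, ∃ c4 ∈ Q, x * r = c1 * p + c2 * q + c3 * r + c4 * u)
    (hxu : ∃ c1 ∈ Q, ∃ c2 ∈ Q, ∃ c3 ∈ Q, ∃ c4 ∈ Q, x * u = c1 * p + c2 * q + c3 * r + c4 * u)
    (n : ℕ) : ∀ i j : ℕ, i + j = n → x ^ i * y ^ j * p ∈ M ∧ x ^ i * y ^ j * q ∈ M ∧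
      x ^ i * y ^ j * r ∈ M ∧ x ^ i * y ^ j * u ∈ M := by
  induction n with
  | zero =>
    intro i j hij
    obtain ⟨rfl, rfl⟩ : i = 0 ∧ j = 0 := by omega
    have := hp 0; have := hq 0; have := hr 0; have := hu 0
    simp_all
  | succ n ih =>
    intro i j hij
    have hy : ∀ w : A, (∃ c1 ∈ Q, ∃ c2 ∈ Q, ∃ c3 ∈ Q, ∃ c4 ∈ Q,
        y * w = c1 * p + c2 * q + c3 * r + c4 * u) → (∀ k : ℕ, x ^ k * w ∈ M) →
        x ^ i * y ^ j * w ∈ M := by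
      rintro w ⟨c1, h1, c2, h2, c3, h3, c4, h4, h⟩ hw
      rcases j with _ | j
      · simpa using hw i
      · obtain ⟨a1, a2, a3, a4⟩ := ih i j (by omega)
        have e : x ^ i * y ^ (j + 1) * w = c1 * (x ^ i * y ^ j * p) + c2 * (x ^ i * y ^ j * q)
            + c3 * (x ^ i * y ^ j * r) + c4 * (x ^ i * y ^ j * u) := by
          linear_combination (x ^ i * y ^ j) * h
        rw [e]
        exact add_mem (add_mem (add_mem (hQ _ h1 _ a1) (hQ _ h2 _ a2)) (hQ _ h3 _ a3))
          (hQ _ h4 _ a4)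
    have hx : ∀ w : A, (∃ c1 ∈ Q, ∃ c2 ∈ Q, ∃ c3 ∈ Q, ∃ c4 ∈ Q,
        x * w = c1 * p + c2 * q + c3 * r + c4 * u) → (∀ k : ℕ, y ^ k * w ∈ M) →
        x ^ i * y ^ j * w ∈ M := by
      rintro w ⟨c1, h1, c2, h2, c3, h3, c4, h4, h⟩ hw
      rcases i with _ | i
      · simpa using hw j
      · obtain ⟨a1, a2, a3, a4⟩ := ih i j (by omega)
        have e : x ^ (i + 1) * y ^ j * w = c1 * (x ^ i * y ^ j * p) + c2 * (x ^ i * y ^ j * q)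
            + c3 * (x ^ i * y ^ j * r) + c4 * (x ^ i * y ^ j * u) := by
          linear_combination (x ^ i * y ^ j) * h
        rw [e]
        exact add_mem (add_mem (add_mem (hQ _ h1 _ a1) (hQ _ h2 _ a2)) (hQ _ h3 _ a3))
          (hQ _ h4 _ a4)
    exact ⟨hy p hyp hp, hy q hyq hq, hx r hxr hr, hx u hxu hu⟩

lemma tr1_mem (i : Fin 4) : tr1 i ∈ Qalg := by
  apply Algebra.subset_adjoin
  fin_cases i <;> simp

lemma tr2_mem01 : tr2 0 1 ∈ Qalg := Algebra.subset_adjoin (by simp)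
lemma tr2_mem12 : tr2 1 2 ∈ Qalg := Algebra.subset_adjoin (by simp)
lemma tr2_mem23 : tr2 2 3 ∈ Qalg := Algebra.subset_adjoin (by simp)
lemma tr2_mem03 : tr2 0 3 ∈ Qalg := Algebra.subset_adjoin (by simp)

lemma hmul_mem {i j : Fin 4} : (1 / 2 : ℂ) • (tr1 i * tr1 j) ∈ Qalg :=
  Qalg.smul_mem (mul_mem (tr1_mem i) (tr1_mem j)) _

lemma bf_mem_diag (i : Fin 4) : bf i i ∈ Qalg := by
  rw [bf_diag]
  exact sub_mem hmul_mem (Qalg.algebraMap_mem 2)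

lemma bf_mem01 : bf 0 1 ∈ Qalg := sub_mem tr2_mem01 hmul_mem
lemma bf_mem12 : bf 1 2 ∈ Qalg := sub_mem tr2_mem12 hmul_mem
lemma bf_mem23 : bf 2 3 ∈ Qalg := sub_mem tr2_mem23 hmul_mem
lemma bf_mem03 : bf 0 3 ∈ Qalg := sub_mem tr2_mem03 hmul_mem

/-- The span of A. -/
noncomputable abbrev Mspan : Submodule Qalg Fn := Submodule.span Qalg Aset

lemma Mspan_mul (c : Fn) (hc : c ∈ Qalg) (f : Fn) (hf : f ∈ Mspan) : c * f ∈ Mspan :=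
  Mspan.smul_mem ⟨c, hc⟩ hf

lemma M_even0 (i j : ℕ) (h : i < 2 ∨ j < 2) : tr2 0 2 ^ i * tr2 1 3 ^ j ∈ Mspan := by
  apply Submodule.subset_span
  unfold Aset
  rcases h with h | h
  · by_cases hj : 2 ≤ j
    · left; right
      refine ⟨j, hj, ?_⟩
      interval_cases i
      · simp
      · simp [mul_comm]
    · left; left
      push Not at hj
      interval_cases i <;> interval_cases j <;> simp
  · by_cases hi : 2 ≤ i
    · left; right
      refine ⟨i, hi, ?_⟩
      interval_cases j
      · simp
      · simp
    · left; left
      push Not at hi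
      interval_cases i <;> interval_cases j <;> simp

lemma two_mem : (2 : Fn) ∈ Qalg := Qalg.algebraMap_mem 2

lemma M_even (i j : ℕ) : tr2 0 2 ^ i * tr2 1 3 ^ j ∈ Mspan := by
  refine even_closure (Qalg : Set Fn) Mspan.toAddSubgroup (tr2 0 2) (tr2 1 3) Mspan_mul M_even0 ?_
    (i + j) i j rfl
  have hc : (1 / 2 : ℂ) • (tr1 0 * tr1 2) ∈ Qalg := hmul_mem
  have hd : (1 / 2 : ℂ) • (tr1 1 * tr1 3) ∈ Qalg := hmul_mem
  have hx : bf 0 2 = tr2 0 2 - (1 / 2 : ℂ) • (tr1 0 * tr1 2) := rfl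
  have hy : bf 1 3 = tr2 1 3 - (1 / 2 : ℂ) • (tr1 1 * tr1 3) := rfl
  have h := gram4
  rw [hx, hy] at h
  have b0 := bf_mem_diag 0
  have b1 := bf_mem_diag 1
  have b2 := bf_mem_diag 2
  have b3 := bf_mem_diag 3
  have b01 := bf_mem01
  have b12 := bf_mem12
  have b23 := bf_mem23
  have b03 := bf_mem03
  have h2 := two_mem
  generalize (1 / 2 : ℂ) • (tr1 0 * tr1 2) = c at *
  generalize (1 / 2 : ℂ) • (tr1 1 * tr1 3) = d at *
  have hα : bf 1 1 * bf 3 3 ∈ Qalg := mul_mem b1 b3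
  have hβ : bf 0 0 * bf 2 2 ∈ Qalg := mul_mem b0 b2
  have hγ : 2 * (bf 0 1 * bf 2 3 + bf 0 3 * bf 1 2) ∈ Qalg :=
    mul_mem h2 (add_mem (mul_mem b01 b23) (mul_mem b03 b12))
  have hδ : (- 2 * bf 0 1 * bf 1 2 * bf 3 3 - 2 * bf 0 3 * bf 2 3 * bf 1 1) ∈ Qalg :=
    sub_mem (mul_mem (mul_mem (mul_mem (neg_mem h2) b01) b12) b3)
      (mul_mem (mul_mem (mul_mem h2 b03) b23) b1)
  have hε : (- 2 * bf 0 1 * bf 0 3 * bf 2 2 - 2 * bf 1 2 * bf 2 3 * bf 0 0) ∈ Qalg :=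
    sub_mem (mul_mem (mul_mem (mul_mem (neg_mem h2) b01) b03) b2)
      (mul_mem (mul_mem (mul_mem h2 b12) b23) b0)
  have hζ : (- bf 0 0 * bf 1 1 * bf 2 2 * bf 3 3 + bf 0 0 * bf 1 1 * bf 2 3 ^ 2
      + bf 0 0 * bf 3 3 * bf 1 2 ^ 2 + bf 1 1 * bf 2 2 * bf 0 3 ^ 2 + bf 2 2 * bf 3 3 * bf 0 1 ^ 2
      - (bf 0 1 * bf 2 3 - bf 0 3 * bf 1 2) ^ 2 ) ∈ Qalg := by
    refine sub_mem (add_mem (add_mem (add_mem (add_mem ?_ ?_) ?_) ?_) ?_) ?_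
    · exact mul_mem (mul_mem (mul_mem (neg_mem b0) b1) b2) b3
    · exact mul_mem (mul_mem b0 b1) (pow_mem b23 2)
    · exact mul_mem (mul_mem b0 b3) (pow_mem b12 2)
    · exact mul_mem (mul_mem b1 b2) (pow_mem b03 2)
    · exact mul_mem (mul_mem b2 b3) (pow_mem b01 2)
    · exact pow_mem (sub_mem (mul_mem b01 b23) (mul_mem b03 b12)) 2
  generalize bf 1 1 * bf 3 3 = α at h hα
  generalize bf 0 0 * bf 2 2 = β at h hβ
  generalize 2 * (bf 0 1 * bf 2 3 + bf 0 3 * bf 1 2) = γ at h hγ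
  generalize (- 2 * bf 0 1 * bf 1 2 * bf 3 3 - 2 * bf 0 3 * bf 2 3 * bf 1 1) = δ at h hδ
  generalize (- 2 * bf 0 1 * bf 0 3 * bf 2 2 - 2 * bf 1 2 * bf 2 3 * bf 0 0) = ε at h hε
  generalize (- bf 0 0 * bf 1 1 * bf 2 2 * bf 3 3 + bf 0 0 * bf 1 1 * bf 2 3 ^ 2
      + bf 0 0 * bf 3 3 * bf 1 2 ^ 2 + bf 1 1 * bf 2 2 * bf 0 3 ^ 2 + bf 2 2 * bf 3 3 * bf 0 1 ^ 2
      - (bf 0 1 * bf 2 3 - bf 0 3 * bf 1 2) ^ 2 ) = ζ at h hζ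
  have mm : ∀ {a b : Fn}, a ∈ Qalg → b ∈ Qalg → a * b ∈ Qalg := fun ha hb => mul_mem ha hb
  have hcd := mm hc hd
  refine ⟨2 * d, mm h2 hd, α - d ^ 2, sub_mem hα (pow_mem hd 2), 2 * c, mm h2 hc,
    β - c ^ 2, sub_mem hβ (pow_mem hc 2), γ - 2 * (2 * (c * d)), sub_mem hγ (mm h2 (mm h2 hcd)),
    2 * (c * d * d) - 2 * (α * c) - γ * d + δ,
    add_mem (sub_mem (sub_mem (mm h2 (mm hcd hd)) (mm h2 (mm hα hc))) (mm hγ hd)) hδ,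
    2 * (c * d * c) - 2 * (β * d) - γ * c + ε,
    add_mem (sub_mem (sub_mem (mm h2 (mm hcd hc)) (mm h2 (mm hβ hd))) (mm hγ hc)) hε,
    α * c ^ 2 + β * d ^ 2 + γ * (c * d) - δ * c - ε * d + ζ - (c * d) ^ 2,
    sub_mem (add_mem (sub_mem (sub_mem (add_mem (add_mem (mm hα (pow_mem hc 2))
      (mm hβ (pow_mem hd 2))) (mm hγ hcd)) (mm hδ hc)) (mm hε hd)) hζ) (pow_mem hcd 2), ?_⟩
  linear_combination h

lemma half_mem {f : Fn} (hf : f ∈ Qalg) : (1 / 2 : ℂ) • f ∈ Qalg := Qalg.smul_mem hf _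

lemma M_pow (g w t : Fn) (k : ℕ) (hg : g ^ k * t ∈ Mspan) (h1 : g ^ k ∈ Mspan)
    (h2 : g ^ (k + 1) ∈ Mspan) (a b : Fn) (ha : a ∈ Qalg) (hb : b ∈ Qalg)
    (e : t = w + (1 / 2 : ℂ) • (a + b * g)) : g ^ k * w ∈ Mspan := by
  have : g ^ k * w = g ^ k * t - ((1 / 2 : ℂ) • a) * g ^ k - ((1 / 2 : ℂ) • b) * g ^ (k + 1) := by
    rw [e]
    simp only [Algebra.smul_def]
    ring
  rw [this]
  exact sub_mem (sub_mem hg (Mspan_mul _ (half_mem ha) _ h1)) (Mspan_mul _ (half_mem hb) _ h2)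

lemma x_mem (k : ℕ) : tr2 0 2 ^ k ∈ Mspan := by simpa using M_even k 0
lemma y_mem (k : ℕ) : tr2 1 3 ^ k ∈ Mspan := by simpa using M_even 0 k

lemma tr2_symm (i j : Fin 4) : tr2 i j = tr2 j i := by
  funext ρ
  exact Matrix.trace_mul_comm _ _

lemma M_p (k : ℕ) : tr2 0 2 ^ k * sf 0 1 2 ∈ Mspan := by
  refine M_pow _ _ (tr3 0 1 2) k (Submodule.subset_span (Or.inr ⟨k, by simp⟩)) (x_mem _) (x_mem _)
    (tr1 0 * tr2 1 2 + tr1 2 * tr2 0 1 - tr1 0 * tr1 1 * tr1 2) (tr1 1) ?_ (tr1_mem _) ?_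
  · exact sub_mem (add_mem (mul_mem (tr1_mem _) tr2_mem12) (mul_mem (tr1_mem _) tr2_mem01))
      (mul_mem (mul_mem (tr1_mem _) (tr1_mem _)) (tr1_mem _))
  · rw [tr3_eq]; congr 2; ring

lemma M_q (k : ℕ) : tr2 0 2 ^ k * sf 0 2 3 ∈ Mspan := by
  refine M_pow _ _ (tr3 0 2 3) k (Submodule.subset_span (Or.inr ⟨k, by simp⟩)) (x_mem _) (x_mem _)
    (tr1 0 * tr2 2 3 + tr1 2 * tr2 0 3 - tr1 0 * tr1 2 * tr1 3) (tr1 3) ?_ (tr1_mem _) ?_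
  · exact sub_mem (add_mem (mul_mem (tr1_mem _) tr2_mem23) (mul_mem (tr1_mem _) tr2_mem03))
      (mul_mem (mul_mem (tr1_mem _) (tr1_mem _)) (tr1_mem _))
  · rw [tr3_eq]; congr 2; ring

lemma M_r (k : ℕ) : tr2 1 3 ^ k * sf 0 1 3 ∈ Mspan := by
  refine M_pow _ _ (tr3 0 1 3) k (Submodule.subset_span (Or.inr ⟨k, by simp⟩)) (y_mem _) (y_mem _)
    (tr1 1 * tr2 0 3 + tr1 3 * tr2 0 1 - tr1 0 * tr1 1 * tr1 3) (tr1 0) ?_ (tr1_mem _) ?_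
  · exact sub_mem (add_mem (mul_mem (tr1_mem _) tr2_mem03) (mul_mem (tr1_mem _) tr2_mem01))
      (mul_mem (mul_mem (tr1_mem _) (tr1_mem _)) (tr1_mem _))
  · rw [tr3_eq]; congr 2; ring

lemma M_u (k : ℕ) : tr2 1 3 ^ k * sf 1 2 3 ∈ Mspan := by
  refine M_pow _ _ (tr3 1 2 3) k (Submodule.subset_span (Or.inr ⟨k, by simp⟩)) (y_mem _) (y_mem _)
    (tr1 1 * tr2 2 3 + tr1 3 * tr2 1 2 - tr1 1 * tr1 2 * tr1 3) (tr1 2) ?_ (tr1_mem _) ?_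
  · exact sub_mem (add_mem (mul_mem (tr1_mem _) tr2_mem23) (mul_mem (tr1_mem _) tr2_mem12))
      (mul_mem (mul_mem (tr1_mem _) (tr1_mem _)) (tr1_mem _))
  · rw [tr3_eq]; congr 2; ring

lemma M_odd (i j : ℕ) : tr2 0 2 ^ i * tr2 1 3 ^ j * sf 0 1 2 ∈ Mspan ∧
    tr2 0 2 ^ i * tr2 1 3 ^ j * sf 0 2 3 ∈ Mspan ∧ tr2 0 2 ^ i * tr2 1 3 ^ j * sf 0 1 3 ∈ Mspan ∧
    tr2 0 2 ^ i * tr2 1 3 ^ j * sf 1 2 3 ∈ Mspan := by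
  have hc : (1 / 2 : ℂ) • (tr1 0 * tr1 2) ∈ Qalg := hmul_mem
  have hd : (1 / 2 : ℂ) • (tr1 1 * tr1 3) ∈ Qalg := hmul_mem
  have hx : bf 0 2 = tr2 0 2 - (1 / 2 : ℂ) • (tr1 0 * tr1 2) := rfl
  have hy : bf 1 3 = tr2 1 3 - (1 / 2 : ℂ) • (tr1 1 * tr1 3) := rfl
  have e0 := sf_rel 0
  have e1 := sf_rel 1
  have e2 := sf_rel 2
  have e3 := sf_rel 3
  rw [bf_symm 1 0] at e1
  rw [bf_symm 2 0, bf_symm 2 1] at e2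
  rw [bf_symm 3 0, bf_symm 3 1, bf_symm 3 2] at e3
  rw [hx] at e0 e2
  rw [hy] at e1 e3
  refine odd_closure (Qalg : Set Fn) Mspan.toAddSubgroup (tr2 0 2) (tr2 1 3) _ _ _ _ Mspan_mul
    M_p M_q M_r M_u ?_ ?_ ?_ ?_ (i + j) i j rfl
  · refine ⟨_, hd, - bf 1 1, neg_mem (bf_mem_diag 1), bf 1 2, bf_mem12, bf 0 1, bf_mem01, ?_⟩
    linear_combination - e1
  · refine ⟨- bf 3 3, neg_mem (bf_mem_diag 3), _, hd, bf 2 3, bf_mem23, bf 0 3, bf_mem03, ?_⟩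
    linear_combination - e3
  · refine ⟨bf 0 3, bf_mem03, bf 0 1, bf_mem01, _, hc, - bf 0 0, neg_mem (bf_mem_diag 0), ?_⟩
    linear_combination e0
  · refine ⟨bf 2 3, bf_mem23, bf 1 2, bf_mem12, - bf 2 2, neg_mem (bf_mem_diag 2), _, hc, ?_⟩
    linear_combination e2

/-- The auxiliary set of module generators. -/
def Eset : Set Fn := {1, sf 0 1 2, sf 0 2 3, sf 0 1 3, sf 1 2 3}

/-- The auxiliary module. -/
noncomputable def Nspan : Submodule Qalg Fn :=
  Submodule.span Qalg {f | ∃ i j : ℕ, ∃ e ∈ Eset, f = tr2 0 2 ^ i * tr2 1 3 ^ j * e}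

lemma Nspan_le : Nspan ≤ Mspan := by
  refine Submodule.span_le.2 ?_
  rintro f ⟨i, j, e, he, rfl⟩
  obtain ⟨h1, h2, h3, h4⟩ := M_odd i j
  rcases he with rfl | rfl | rfl | rfl | rfl
  · rw [mul_one]; exact M_even i j
  all_goals assumption

/-- The multiplier algebra of the auxiliary module. -/
noncomputable def Stab : Subalgebra ℂ Fn where
  carrier := {c | ∀ f ∈ Nspan, c * f ∈ Nspan}
  mul_mem' := by
    intro a b ha hb f hf
    rw [mul_assoc]; exact ha _ (hb _ hf)
  add_mem' := by
    intro a b ha hb f hf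
    rw [add_mul]; exact add_mem (ha _ hf) (hb _ hf)
  algebraMap_mem' := by
    intro r f hf
    exact Nspan.smul_mem (algebraMap ℂ Qalg r) hf

lemma Stab_of (c : Fn) (h : ∀ i j : ℕ, ∀ e ∈ Eset, c * (tr2 0 2 ^ i * tr2 1 3 ^ j * e) ∈ Nspan) :
    c ∈ Stab := by
  intro f hf
  unfold Nspan at hf
  induction hf using Submodule.span_induction with
  | mem _ hf =>
    obtain ⟨i, j, e, he, rfl⟩ := hf
    exact h i j e he
  | zero => simp
  | add a b _ _ ha hb => rw [mul_add]; exact add_mem ha hb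
  | smul a b _ hb => rw [mul_smul_comm]; exact Nspan.smul_mem a hb

lemma N_gen (i j : ℕ) (e : Fn) (he : e ∈ Eset) : tr2 0 2 ^ i * tr2 1 3 ^ j * e ∈ Nspan :=
  Submodule.subset_span ⟨i, j, e, he, rfl⟩

lemma Q_le_Stab : Qalg ≤ Stab := fun c hc f hf => Nspan.smul_mem ⟨c, hc⟩ hf

lemma x_Stab : tr2 0 2 ∈ Stab := by
  apply Stab_of
  intro i j e he
  have := N_gen (i + 1) j e he
  convert this using 1
  ring

lemma y_Stab : tr2 1 3 ∈ Stab := by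
  apply Stab_of
  intro i j e he
  have := N_gen i (j + 1) e he
  convert this using 1
  ring

lemma one_N : (1 : Fn) ∈ Nspan := by simpa using N_gen 0 0 1 (by simp [Eset])

lemma bf_Stab (i j : Fin 4) : bf i j ∈ Stab := by
  have h : ∀ i j : Fin 4, i < j → bf i j ∈ Stab := by
    intro i j hij
    have hm : (1 / 2 : ℂ) • (tr1 i * tr1 j) ∈ Stab := Q_le_Stab hmul_mem
    refine sub_mem ?_ hm
    fin_cases i <;> fin_cases j <;> first | (exfalso; revert hij; decide) | skip
    · exact Q_le_Stab tr2_mem01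
    · exact x_Stab
    · exact Q_le_Stab tr2_mem03
    · exact Q_le_Stab tr2_mem12
    · exact y_Stab
    · exact Q_le_Stab tr2_mem23
  rcases lt_trichotomy i j with hij | rfl | hij
  · exact h i j hij
  · exact Q_le_Stab (bf_mem_diag i)
  · rw [bf_symm]; exact h j i hij

lemma gm_Stab (i j k l m n : Fin 4) : gm i j k l m n ∈ Stab :=
  add_mem (sub_mem
    (mul_mem (bf_Stab _ _) (sub_mem (mul_mem (bf_Stab _ _) (bf_Stab _ _))
      (mul_mem (bf_Stab _ _) (bf_Stab _ _))))
    (mul_mem (bf_Stab _ _) (sub_mem (mul_mem (bf_Stab _ _) (bf_Stab _ _))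
      (mul_mem (bf_Stab _ _) (bf_Stab _ _)))))
    (mul_mem (bf_Stab _ _) (sub_mem (mul_mem (bf_Stab _ _) (bf_Stab _ _))
      (mul_mem (bf_Stab _ _) (bf_Stab _ _))))

lemma sf_Stab (i j k : Fin 4) (h : sf i j k ∈ Eset) : sf i j k ∈ Stab := by
  apply Stab_of
  intro a b e he
  have hxy : tr2 0 2 ^ a * tr2 1 3 ^ b ∈ Stab := mul_mem (pow_mem x_Stab a) (pow_mem y_Stab b)
  have key : ∀ l m n : Fin 4,
      sf i j k * (tr2 0 2 ^ a * tr2 1 3 ^ b * sf l m n) ∈ Nspan := by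
    intro l m n
    have h1 : tr2 0 2 ^ a * tr2 1 3 ^ b * ((-1 / 2 : ℂ) • gm i j k l m n) ∈ Stab :=
      mul_mem hxy (Stab.smul_mem (gm_Stab _ _ _ _ _ _) _)
    have h2 := h1 1 one_N
    convert h2 using 1
    rw [← sf_mul]; ring
  rcases he with rfl | rfl | rfl | rfl | rfl
  · rw [mul_one, mul_comm]; exact N_gen _ _ _ h
  all_goals apply key

lemma tr2_Stab (i j : Fin 4) : tr2 i j ∈ Stab := by
  have : tr2 i j = bf i j + (1 / 2 : ℂ) • (tr1 i * tr1 j) := by simp [bf]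
  rw [this]
  exact add_mem (bf_Stab _ _) (Q_le_Stab hmul_mem)

lemma tr1_Stab (i : Fin 4) : tr1 i ∈ Stab := Q_le_Stab (tr1_mem i)

lemma tr3_Stab (i j k : Fin 4) (hij : i < j) (hjk : j < k) : tr3 i j k ∈ Stab := by
  have h : sf i j k ∈ Eset := by
    fin_cases i <;> fin_cases j <;> first | (exfalso; revert hij; decide) | skip
    all_goals fin_cases k <;> first | (exfalso; revert hjk; decide) | simp [Eset]
  rw [tr3_eq]
  exact add_mem (sf_Stab _ _ _ h) (Stab.smul_mem (sub_mem (add_mem (add_mem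
    (mul_mem (tr1_Stab _) (tr2_Stab _ _)) (mul_mem (tr1_Stab _) (tr2_Stab _ _)))
    (mul_mem (tr1_Stab _) (tr2_Stab _ _)))
    (mul_mem (mul_mem (tr1_Stab _) (tr1_Stab _)) (tr1_Stab _))) _)

lemma tr4_Stab : tr4 ∈ Stab := by
  have m1 := tr1_Stab
  have m2 := tr2_Stab
  have a : tr3 0 1 2 ∈ Stab := tr3_Stab _ _ _ (by decide) (by decide)
  have b : tr3 0 2 3 ∈ Stab := tr3_Stab _ _ _ (by decide) (by decide)
  have c : tr3 0 1 3 ∈ Stab := tr3_Stab _ _ _ (by decide) (by decide)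
  have d : tr3 1 2 3 ∈ Stab := tr3_Stab _ _ _ (by decide) (by decide)
  rw [tr4_eq]
  apply Stab.smul_mem
  have mm : ∀ {f g : Fn}, f ∈ Stab → g ∈ Stab → f * g ∈ Stab := fun hf hg => mul_mem hf hg
  have ma : ∀ {f g : Fn}, f ∈ Stab → g ∈ Stab → f + g ∈ Stab := fun hf hg => add_mem hf hg
  have ms : ∀ {f g : Fn}, f ∈ Stab → g ∈ Stab → f - g ∈ Stab := fun hf hg => sub_mem hf hg
  exact ms (ms (ms (ms (ms (ma (ma (ma (ma (ma (ma (mm (mm (mm (m1 0) (m1 1)) (m1 2)) (m1 3))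
    (mm (m1 0) d)) (mm (m1 1) b)) (mm (m1 2) c)) (mm (m1 3) a)) (mm (m2 0 1) (m2 2 3)))
    (mm (m2 0 3) (m2 1 2))) (mm (m2 0 2) (m2 1 3))) (mm (mm (m1 0) (m1 1)) (m2 2 3)))
    (mm (mm (m1 0) (m1 3)) (m2 1 2))) (mm (mm (m1 1) (m1 2)) (m2 0 3)))
    (mm (mm (m1 2) (m1 3)) (m2 0 1))

lemma X_span : ∀ f ∈ Xalg, f ∈ Submodule.span Qalg Aset := by
  have h : Xalg ≤ Stab := by
    apply Algebra.adjoin_le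
    rintro f (⟨i, rfl⟩ | ⟨i, j, -, rfl⟩ | ⟨i, j, k, hij, hjk, rfl⟩ | rfl)
    · exact tr1_Stab i
    · exact tr2_Stab i j
    · exact tr3_Stab i j k hij hjk
    · exact tr4_Stab
  intro f hf
  apply Nspan_le
  simpa using h hf 1 one_N

lemma A_sub : Aset ⊆ (Xalg : Set Fn) := by
  have h2 : ∀ i j : Fin 4, i < j → tr2 i j ∈ Xalg := fun i j h =>
    Algebra.subset_adjoin (Or.inr (Or.inl ⟨i, j, h, rfl⟩))
  have h3 : ∀ i j k : Fin 4, i < j → j < k → tr3 i j k ∈ Xalg := fun i j k h h' =>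
    Algebra.subset_adjoin (Or.inr (Or.inr (Or.inl ⟨i, j, k, h, h', rfl⟩)))
  have hx := h2 0 2 (by decide)
  have hy := h2 1 3 (by decide)
  have a := h3 0 1 2 (by decide) (by decide)
  have b := h3 0 2 3 (by decide) (by decide)
  have c := h3 0 1 3 (by decide) (by decide)
  have d := h3 1 2 3 (by decide) (by decide)
  rintro f (((rfl | rfl | rfl | rfl) | ⟨k, -, rfl | rfl | rfl | rfl⟩) |
    ⟨k, rfl | rfl | rfl | rfl⟩)
  · exact one_mem Xalg
  · exact hx
  · exact hy
  all_goals
    repeat' first | assumption | apply mul_mem | apply pow_mem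

end Spanning

section Indep

open Polynomial

/-- Polynomial ring modelling `Q`. -/
abbrev RR : Type := MvPolynomial (Fin 8) ℂ

/-- Generators of `Q`. -/
noncomputable def qv : Fin 8 → Fn :=
  ![tr1 0, tr1 1, tr1 2, tr1 3, tr2 0 1, tr2 1 2, tr2 2 3, tr2 0 3]

/-- values of the generators at a point -/
noncomputable def qp (ρ : Fin 4 → SL2) : Fin 8 → ℂ := fun i => qv i ρ

/-- evaluation in one extra variable -/
noncomputable def evp (q : Fin 8 → ℂ) (x : ℂ) : RR[X] →+* ℂ :=
  Polynomial.eval₂RingHom (MvPolynomial.eval q) x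

/-- evaluation in two extra variables; the outer variable is `x`, the inner one is `y`. -/
noncomputable def evT (q : Fin 8 → ℂ) (x y : ℂ) : RR[X][X] →+* ℂ :=
  Polynomial.eval₂RingHom (evp q y) x

/-- inclusion of polynomials in the outer variable -/
noncomputable def iot : RR[X] →+* RR[X][X] := Polynomial.mapRingHom C

@[simp] lemma evp_C (q x) (r : RR) : evp q x (C r) = MvPolynomial.eval q r := by simp [evp]
@[simp] lemma evp_X (q x) : evp q x X = x := by simp [evp]
@[simp] lemma evT_C (q x y) (r : RR[X]) : evT q x y (C r) = evp q y r := by simp [evT]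
@[simp] lemma evT_X (q x y) : evT q x y X = x := by simp [evT]
@[simp] lemma iot_C (r : RR) : iot (C r) = C (C r) := by simp [iot]
@[simp] lemma iot_X : iot X = X := by simp [iot]
@[simp] lemma evT_iot (q x y) (r : RR[X]) : evT q x y (iot r) = evp q x r := by
  have : (evT q x y).comp iot = evp q x := by
    apply Polynomial.ringHom_ext
    · intro a; simp
    · simp
  exact DFunLike.congr_fun this r
@[simp] lemma iot_coeff (r : RR[X]) (i : ℕ) : (iot r).coeff i = C (r.coeff i) := by simp [iot]

lemma evp_zero (r : RR[X]) (h : ∀ q x, evp q x r = 0) : r = 0 := by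
  ext1 n
  apply MvPolynomial.funext
  intro q
  have : r.map (MvPolynomial.eval q) = 0 := by
    apply Polynomial.funext
    intro x
    rw [Polynomial.eval_map]
    simpa [evp] using h q x
  have h2 := congrArg (fun p => p.coeff n) this
  simpa using h2

/-- Construct a quadruple from coordinates. -/
noncomputable def mkρ (t z p q : Fin 4 → ℂ) (h : ∀ i, t i ^ 2 / 4 - z i ^ 2 - p i * q i = 1) :
    Fin 4 → SL2 := fun i => ⟨!![t i / 2 + z i, p i; q i, t i / 2 - z i], by
      rw [Matrix.det_fin_two_of]; linear_combination h i⟩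

lemma mkρ_tr1 (t z p q h i) : tr1 i (mkρ t z p q h) = t i := by
  rw [tr1_apply]; simp [mkρ]

lemma mkρ_tr2 (t z p q h i j) : tr2 i j (mkρ t z p q h) =
    t i * t j / 2 + 2 * z i * z j + p i * q j + q i * p j := by
  simp [mkρ, tr2, Matrix.trace, Fin.sum_univ_two]
  ring

lemma exists_pair (t1 t2 t3 t4 b11 b22 b33 b44 b12 b23 b34 b14 b13 : ℂ)
    (h11 : b11 = t1 ^ 2 / 2 - 2) (h22 : b22 = t2 ^ 2 / 2 - 2) (h33 : b33 = t3 ^ 2 / 2 - 2)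
    (h44 : b44 = t4 ^ 2 / 2 - 2)
    (k1 : b11 ≠ 0) (k2 : b11 * b33 - b13 ^ 2 ≠ 0)
    (k3 : b11 * b22 * b33 + 2 * b12 * b23 * b13 - b11 * b23 ^ 2 - b22 * b13 ^ 2
      - b33 * b12 ^ 2 ≠ 0)
    (k4 : b11 * b44 * b33 + 2 * b14 * b34 * b13 - b11 * b34 ^ 2 - b44 * b13 ^ 2
      - b33 * b14 ^ 2 ≠ 0) :
    ∃ z p q : Fin 4 → ℂ, ∃ p' q' : Fin 4 → ℂ,
      (∀ i, ![t1, t2, t3, t4] i ^ 2 / 4 - z i ^ 2 - p i * q i = 1) ∧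
      (∀ i, ![t1, t2, t3, t4] i ^ 2 / 4 - z i ^ 2 - p' i * q' i = 1) ∧
      2 * z 0 * z 1 + p 0 * q 1 + q 0 * p 1 = b12 ∧
      2 * z 1 * z 2 + p 1 * q 2 + q 1 * p 2 = b23 ∧
      2 * z 2 * z 3 + p 2 * q 3 + q 2 * p 3 = b34 ∧
      2 * z 0 * z 3 + p 0 * q 3 + q 0 * p 3 = b14 ∧
      2 * z 0 * z 2 + p 0 * q 2 + q 0 * p 2 = b13 ∧
      2 * z 0 * z 1 + p' 0 * q' 1 + q' 0 * p' 1 = b12 ∧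
      2 * z 1 * z 2 + p' 1 * q' 2 + q' 1 * p' 2 = b23 ∧
      2 * z 2 * z 3 + p' 2 * q' 3 + q' 2 * p' 3 = b34 ∧
      2 * z 0 * z 3 + p' 0 * q' 3 + q' 0 * p' 3 = b14 ∧
      2 * z 0 * z 2 + p' 0 * q' 2 + q' 0 * p' 2 = b13 ∧
      p 1 * q 3 + q 1 * p 3 ≠ p' 1 * q' 3 + q' 1 * p' 3 := by
  obtain ⟨z, hz⟩ := IsAlgClosed.exists_pow_nat_eq (b11 / 2) (n := 2) (by norm_num)
  have hb : b11 = 2 * z ^ 2 := by rw [hz]; ring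
  have z0 : z ≠ 0 := by rintro rfl; apply k1; rw [hb]; ring
  obtain ⟨z2, hz2⟩ : ∃ w, b12 = 2 * z * w := ⟨b12 / (2 * z), by field_simp⟩
  obtain ⟨z3, hz3⟩ : ∃ w, b13 = 2 * z * w := ⟨b13 / (2 * z), by field_simp⟩
  obtain ⟨z4, hz4⟩ : ∃ w, b14 = 2 * z * w := ⟨b14 / (2 * z), by field_simp⟩
  obtain ⟨c, hc⟩ : ∃ c, b33 = 2 * c + 2 * z3 ^ 2 := ⟨b33 / 2 - z3 ^ 2, by ring⟩
  obtain ⟨n, hn⟩ : ∃ c, b22 = 2 * c + 2 * z2 ^ 2 := ⟨b22 / 2 - z2 ^ 2, by ring⟩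
  obtain ⟨n', hn'⟩ : ∃ c, b44 = 2 * c + 2 * z4 ^ 2 := ⟨b44 / 2 - z4 ^ 2, by ring⟩
  obtain ⟨m, hm⟩ : ∃ c, b23 = c + 2 * z2 * z3 := ⟨b23 - 2 * z2 * z3, by ring⟩
  obtain ⟨m', hm'⟩ : ∃ c, b34 = c + 2 * z4 * z3 := ⟨b34 - 2 * z4 * z3, by ring⟩
  obtain ⟨w, hw⟩ := IsAlgClosed.exists_pow_nat_eq (m ^ 2 - 4 * n * c) (n := 2) (by norm_num)
  obtain ⟨w', hw'⟩ := IsAlgClosed.exists_pow_nat_eq (m' ^ 2 - 4 * n' * c) (n := 2) (by norm_num)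
  have c0 : c ≠ 0 := by
    rintro rfl; apply k2; rw [hb, hc, hz3]; ring
  have w0 : w ≠ 0 := by
    rintro rfl; apply k3; rw [hb, hc, hz3, hn, hz2, hm]; linear_combination (2 * z ^ 2) * hw
  have w0' : w' ≠ 0 := by
    rintro rfl; apply k4; rw [hb, hc, hz3, hn', hz4, hm']; linear_combination (2 * z ^ 2) * hw'
  have d1 : t1 ^ 2 / 4 - z ^ 2 - 0 * 0 = 1 := by linear_combination (- 1 / 2) * h11 + hb / 2
  have d3 : t3 ^ 2 / 4 - z3 ^ 2 - 1 * c = 1 := by linear_combination (- 1 / 2) * h33 + hc / 2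
  have d2 : t2 ^ 2 / 4 - z2 ^ 2 - (m - w) / (2 * c) * ((m + w) / 2) = 1 := by
    have : (m - w) / (2 * c) * ((m + w) / 2) = n := by
      field_simp; linear_combination - hw
    rw [this]; linear_combination (- 1 / 2) * h22 + hn / 2
  have d4 : t4 ^ 2 / 4 - z4 ^ 2 - (m' - w') / (2 * c) * ((m' + w') / 2) = 1 := by
    have : (m' - w') / (2 * c) * ((m' + w') / 2) = n' := by
      field_simp; linear_combination - hw'
    rw [this]; linear_combination (- 1 / 2) * h44 + hn' / 2
  have d4' : t4 ^ 2 / 4 - z4 ^ 2 - (m' + w') / (2 * c) * ((m' - w') / 2) = 1 := by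
    rw [← d4]; ring
  refine ⟨![z, z2, z3, z4], ![0, (m - w) / (2 * c), 1, (m' - w') / (2 * c)],
    ![0, (m + w) / 2, c, (m' + w') / 2], ![0, (m - w) / (2 * c), 1, (m' + w') / (2 * c)],
    ![0, (m + w) / 2, c, (m' - w') / 2], ?_, ?_, ?_⟩
  · intro i
    fin_cases i
    exacts [d1, d2, d3, d4]
  · intro i
    fin_cases i
    exacts [d1, d2, d3, d4']
  · simp only [Matrix.cons_val]
    refine ⟨?_, ?_, ?_, ?_, ?_, ?_, ?_, ?_, ?_, ?_, ?_⟩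
    · rw [hz2]; ring
    · rw [hm]; field_simp; ring
    · rw [hm']; field_simp; ring
    · rw [hz4]; ring
    · rw [hz3]; ring
    · rw [hz2]; ring
    · rw [hm]; field_simp; ring
    · rw [hm']; field_simp; ring
    · rw [hz4]; ring
    · rw [hz3]; ring
    · intro h
      field_simp at h
      have : w * w' = 0 := by linear_combination (- 1 / 4) * h
      exact mul_ne_zero w0 w0' this

/-- genericity condition -/
def dgen {A : Type*} [CommRing A] (half : A) (q : Fin 8 → A) (x : A) : A :=
  let b11 := half * q 0 ^ 2 - 2
  let b22 := half * q 1 ^ 2 - 2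
  let b33 := half * q 2 ^ 2 - 2
  let b44 := half * q 3 ^ 2 - 2
  let b12 := q 4 - half * q 0 * q 1
  let b23 := q 5 - half * q 1 * q 2
  let b34 := q 6 - half * q 2 * q 3
  let b14 := q 7 - half * q 0 * q 3
  let b13 := x - half * q 0 * q 2
  b11 * (b11 * b33 - b13 ^ 2) *
   (b11 * b22 * b33 + 2 * b12 * b23 * b13 - b11 * b23 ^ 2 - b22 * b13 ^ 2 - b33 * b12 ^ 2) *
   (b11 * b44 * b33 + 2 * b14 * b34 * b13 - b11 * b34 ^ 2 - b44 * b13 ^ 2 - b33 * b14 ^ 2)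

lemma map_dgen {A B : Type*} [CommRing A] [CommRing B] (f : A →+* B) (half : A) (q : Fin 8 → A)
    (x : A) : f (dgen half q x) = dgen (f half) (fun i => f (q i)) (f x) := by
  have h2 : f 2 = 2 := map_ofNat f 2
  simp [dgen, h2]

lemma exists_rho (q : Fin 8 → ℂ) (x : ℂ) (h : dgen (1 / 2) q x ≠ 0) :
    ∃ ρ ρ' : Fin 4 → SL2, qp ρ = q ∧ qp ρ' = q ∧ tr2 0 2 ρ = x ∧ tr2 0 2 ρ' = x ∧
      tr2 1 3 ρ ≠ tr2 1 3 ρ' := by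
  simp only [dgen, ne_eq, mul_eq_zero, not_or] at h
  obtain ⟨⟨⟨k1, k2⟩, k3⟩, k4⟩ := h
  obtain ⟨z, p, r, p', r', h1, h2, e1, e2, e3, e4, e5, f1, f2, f3, f4, f5, hne⟩ :=
    exists_pair (q 0) (q 1) (q 2) (q 3) _ (1 / 2 * q 1 ^ 2 - 2) _ (1 / 2 * q 3 ^ 2 - 2) _ _ _ _ _
      (by ring) (by ring) (by ring) (by ring) k1 k2 k3 k4
  refine ⟨mkρ _ z p r h1, mkρ _ z p' r' h2, ?_, ?_, ?_, ?_, ?_⟩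
  · funext i
    fin_cases i <;> simp [qp, qv, mkρ_tr1, mkρ_tr2]
    · linear_combination e1
    · linear_combination e2
    · linear_combination e3
    · linear_combination e4
  · funext i
    fin_cases i <;> simp [qp, qv, mkρ_tr1, mkρ_tr2]
    · linear_combination f1
    · linear_combination f2
    · linear_combination f3
    · linear_combination f4
  · simp [mkρ_tr2]; linear_combination e5
  · simp [mkρ_tr2]; linear_combination f5
  · intro h
    apply hne
    simp only [mkρ_tr2] at h
    linear_combination h

lemma indep_x (r0 r1 : RR[X])
    (h : ∀ ρ, evp (qp ρ) (tr2 0 2 ρ) r0 + evp (qp ρ) (tr2 0 2 ρ) r1 * tr2 1 3 ρ = 0) :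
    r0 = 0 ∧ r1 = 0 := by
  set D : RR[X] := dgen (C (MvPolynomial.C (1 / 2))) (fun i => C (MvPolynomial.X i)) X with hD
  have hDe : ∀ q x, evp q x D = dgen (1 / 2) q x := by
    intro q x
    rw [hD, map_dgen]
    congr 1 <;> simp
  have D0 : D ≠ 0 := by
    intro h0
    have := hDe 0 0
    rw [h0] at this
    norm_num [dgen] at this
  have key : ∀ q x, dgen (1 / 2) q x ≠ 0 → evp q x r0 = 0 ∧ evp q x r1 = 0 := by
    intro q x hq
    obtain ⟨ρ, ρ', rfl, h2, rfl, h4, h5⟩ := exists_rho q x hq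
    have e1 := h ρ
    have e2 := h ρ'
    rw [h2, h4] at e2
    have e3 : evp (qp ρ) (tr2 0 2 ρ) r1 * (tr2 1 3 ρ - tr2 1 3 ρ') = 0 := by
      linear_combination e1 - e2
    have e4 := (mul_eq_zero.1 e3).resolve_right (sub_ne_zero.2 h5)
    rw [e4] at e1
    exact ⟨by simpa using e1, e4⟩
  have fin : ∀ r : RR[X], (∀ q x, dgen (1 / 2) q x ≠ 0 → evp q x r = 0) → r = 0 := by
    intro r hr
    have : r * D = 0 := by
      apply evp_zero
      intro q x
      rw [map_mul, hDe]
      by_cases hq : dgen (1 / 2) q x = 0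
      · rw [hq, mul_zero]
      · rw [hr q x hq, zero_mul]
    exact (mul_eq_zero.1 this).resolve_right D0
  exact ⟨fin r0 fun q x hq => (key q x hq).1, fin r1 fun q x hq => (key q x hq).2⟩

/-- cyclic relabelling of the generators -/
def cyc : Fin 8 → Fin 8 := ![1, 2, 3, 0, 5, 6, 7, 4]

/-- inverse of cyclic relabelling of the generators -/
def cyc' : Fin 8 → Fin 8 := ![3, 0, 1, 2, 7, 4, 5, 6]

lemma indep_y (r0 r1 : RR[X])
    (h : ∀ ρ, evp (qp ρ) (tr2 1 3 ρ) r0 + evp (qp ρ) (tr2 1 3 ρ) r1 * tr2 0 2 ρ = 0) :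
    r0 = 0 ∧ r1 = 0 := by
  let f : RR →+* RR := (MvPolynomial.rename cyc' : RR →ₐ[ℂ] RR).toRingHom
  have finj : Function.Injective f := by
    apply MvPolynomial.rename_injective
    decide
  have hf : ∀ q x (r : RR[X]), evp q x (r.map f) = evp (q ∘ cyc') x r := by
    intro q x r
    simp only [evp, coe_eval₂RingHom, Polynomial.eval₂_map]
    congr 1
    apply MvPolynomial.ringHom_ext
    · intro a; simp [f]
    · intro i; simp [f]
  have := indep_x (r0.map f) (r1.map f) ?_
  · exact ⟨(Polynomial.map_eq_zero_iff finj).1 this.1, (Polynomial.map_eq_zero_iff finj).1 this.2⟩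
  · intro σ
    have hh := h (fun i => σ (i - 1))
    rw [hf, hf]
    have e1 : qp (fun i => σ (i - 1)) = qp σ ∘ cyc' := by
      funext i
      fin_cases i
      · rfl
      · rfl
      · rfl
      · rfl
      · exact congrFun (tr2_symm 3 0) σ
      · rfl
      · rfl
      · exact congrFun (tr2_symm 3 2) σ
    rw [e1] at hh
    have e2 : tr2 1 3 (fun i => σ (i - 1)) = tr2 0 2 σ := rfl
    have e3 : tr2 0 2 (fun i => σ (i - 1)) = tr2 1 3 σ := congrFun (tr2_symm 3 1) σ
    rwa [e2, e3] at hh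

end Indep
section Indep2

open Polynomial

noncomputable def β11 : RR := MvPolynomial.C (1 / 2) * MvPolynomial.X 0 ^ 2 - MvPolynomial.C 2
noncomputable def β22 : RR := MvPolynomial.C (1 / 2) * MvPolynomial.X 1 ^ 2 - MvPolynomial.C 2
noncomputable def β33 : RR := MvPolynomial.C (1 / 2) * MvPolynomial.X 2 ^ 2 - MvPolynomial.C 2
noncomputable def β44 : RR := MvPolynomial.C (1 / 2) * MvPolynomial.X 3 ^ 2 - MvPolynomial.C 2
noncomputable def β12 : RR :=
  MvPolynomial.X 4 - MvPolynomial.C (1 / 2) * (MvPolynomial.X 0 * MvPolynomial.X 1)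
noncomputable def β23 : RR :=
  MvPolynomial.X 5 - MvPolynomial.C (1 / 2) * (MvPolynomial.X 1 * MvPolynomial.X 2)
noncomputable def β34 : RR :=
  MvPolynomial.X 6 - MvPolynomial.C (1 / 2) * (MvPolynomial.X 2 * MvPolynomial.X 3)
noncomputable def β14 : RR :=
  MvPolynomial.X 7 - MvPolynomial.C (1 / 2) * (MvPolynomial.X 0 * MvPolynomial.X 3)
noncomputable def γ13 : RR := MvPolynomial.C (1 / 2) * (MvPolynomial.X 0 * MvPolynomial.X 2)
noncomputable def γ24 : RR := MvPolynomial.C (1 / 2) * (MvPolynomial.X 1 * MvPolynomial.X 3)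

lemma ev11 (ρ) : MvPolynomial.eval (qp ρ) β11 = bf 0 0 ρ := by
  rw [bf_diag]; simp [β11, qp, qv]; ring
lemma ev22 (ρ) : MvPolynomial.eval (qp ρ) β22 = bf 1 1 ρ := by
  rw [bf_diag]; simp [β22, qp, qv]; ring
lemma ev33 (ρ) : MvPolynomial.eval (qp ρ) β33 = bf 2 2 ρ := by
  rw [bf_diag]; simp [β33, qp, qv]; ring
lemma ev44 (ρ) : MvPolynomial.eval (qp ρ) β44 = bf 3 3 ρ := by
  rw [bf_diag]; simp [β44, qp, qv]; ring
lemma ev12 (ρ) : MvPolynomial.eval (qp ρ) β12 = bf 0 1 ρ := by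
  simp [β12, qp, qv, bf]
lemma ev23 (ρ) : MvPolynomial.eval (qp ρ) β23 = bf 1 2 ρ := by
  simp [β23, qp, qv, bf]
lemma ev34 (ρ) : MvPolynomial.eval (qp ρ) β34 = bf 2 3 ρ := by
  simp [β34, qp, qv, bf]
lemma ev14 (ρ) : MvPolynomial.eval (qp ρ) β14 = bf 0 3 ρ := by
  simp [β14, qp, qv, bf]
lemma ev13 (ρ) : tr2 0 2 ρ - MvPolynomial.eval (qp ρ) γ13 = bf 0 2 ρ := by
  simp [γ13, qp, qv, bf]
lemma ev24 (ρ) : tr2 1 3 ρ - MvPolynomial.eval (qp ρ) γ24 = bf 1 3 ρ := by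
  simp [γ24, qp, qv, bf]

/-- the shifted outer variable in one-variable polynomials -/
noncomputable def x1 : RR[X] := X - C γ13
/-- the shifted inner variable in one-variable polynomials -/
noncomputable def y1 : RR[X] := X - C γ24

lemma ev_x1 (ρ) : evp (qp ρ) (tr2 0 2 ρ) x1 = bf 0 2 ρ := by
  rw [← ev13]; simp [x1]
lemma ev_y1 (ρ) : evp (qp ρ) (tr2 1 3 ρ) y1 = bf 1 3 ρ := by
  rw [← ev24]; simp [y1]

noncomputable def Apol : RR[X] := x1 ^ 2 - C (β11 * β33)
noncomputable def e1pol : RR[X] := - (2 * C (β12 * β34 + β14 * β23)) * x1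
    - C (- 2 * β12 * β14 * β33 - 2 * β23 * β34 * β11)
noncomputable def e0pol : RR[X] := - C (β22 * β44) * x1 ^ 2
    - C (- 2 * β12 * β23 * β44 - 2 * β14 * β34 * β22) * x1
    - C (- β11 * β22 * β33 * β44 + β11 * β22 * β34 ^ 2
      + β11 * β44 * β23 ^ 2 + β22 * β33 * β14 ^ 2 + β33 * β44 * β12 ^ 2
      - (β12 * β34 - β14 * β23) ^ 2)

noncomputable def Gpol : RR[X][X] := iot Apol * C y1 ^ 2 + iot e1pol * C y1 + iot e0pol

lemma ev_G (ρ) : evT (qp ρ) (tr2 0 2 ρ) (tr2 1 3 ρ) Gpol = 0 := by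
  have h := congrFun gram4 ρ
  simp only [Pi.mul_apply, Pi.sub_apply, Pi.add_apply, Pi.pow_apply, Pi.neg_apply,
    Pi.ofNat_apply] at h
  simp only [Gpol, Apol, e1pol, e0pol, map_add, map_sub, map_mul, map_pow, map_neg, evT_iot, evT_C,
    evp_C, ev_x1, ev_y1, ev11, ev22, ev33, ev44, ev12, ev23, ev34, ev14, map_ofNat]
  linear_combination h

noncomputable def g2pol : RR[X] := y1 ^ 2 - C (β22 * β44)

noncomputable def g1pol : RR[X] := - (2 * C (β12 * β34 + β14 * β23)) * y1
    - C (- 2 * β12 * β23 * β44 - 2 * β14 * β34 * β22)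
noncomputable def g0pol : RR[X] := - C (β11 * β33) * y1 ^ 2
    - C (- 2 * β12 * β14 * β33 - 2 * β23 * β34 * β11) * y1
    - C (- β11 * β22 * β33 * β44 + β11 * β22 * β34 ^ 2
      + β11 * β44 * β23 ^ 2 + β22 * β33 * β14 ^ 2 + β33 * β44 * β12 ^ 2
      - (β12 * β34 - β14 * β23) ^ 2)

lemma G_eq : Gpol = C g2pol * X ^ 2 + C (g1pol - 2 * C γ13 * g2pol) * X
    + C (g0pol - C γ13 * g1pol + C γ13 ^ 2 * g2pol) := by
  simp only [Gpol, Apol, e1pol, e0pol, g2pol, g1pol, g0pol, map_add, map_sub, map_mul, map_pow,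
    map_neg, iot_C, iot_X, x1, map_ofNat]
  ring

lemma g2_monic : g2pol.Monic ∧ g2pol.natDegree = 2 := by
  have : g2pol = (X - C γ24) ^ 2 - C (β22 * β44) := rfl
  have m : ((X - C γ24) ^ 2 : RR[X]).Monic := (monic_X_sub_C _).pow 2
  have d : ((X - C γ24) ^ 2 : RR[X]).natDegree = 2 := by
    rw [(monic_X_sub_C _).natDegree_pow]; simp
  rw [this]
  constructor
  · apply m.sub_of_left
    refine lt_of_le_of_lt degree_C_le ?_
    rw [degree_eq_natDegree m.ne_zero, d]; norm_num
  · rw [natDegree_sub_C, d]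

lemma A_monic : Apol.Monic ∧ Apol.natDegree = 2 := by
  have : Apol = (X - C γ13) ^ 2 - C (β11 * β33) := rfl
  have m : ((X - C γ13) ^ 2 : RR[X]).Monic := (monic_X_sub_C _).pow 2
  have d : ((X - C γ13) ^ 2 : RR[X]).natDegree = 2 := by
    rw [(monic_X_sub_C _).natDegree_pow]; simp
  rw [this]
  constructor
  · apply m.sub_of_left
    refine lt_of_le_of_lt degree_C_le ?_
    rw [degree_eq_natDegree m.ne_zero, d]; norm_num
  · rw [natDegree_sub_C, d]

lemma G_lc : Gpol.leadingCoeff = g2pol := by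
  rw [G_eq]
  exact leadingCoeff_quadratic g2_monic.1.ne_zero

lemma rcancel (A : Type*) [CommRing A] : IsRightCancelAdd A[X] := inferInstance

instance instRC2 : IsRightCancelAdd RR[X][X] := rcancel RR[X]

/-- pseudo-reducible elements -/
def Red (F : RR[X][X]) : Prop := ∃ (N : ℕ) (H : RR[X][X]) (r0 r1 : RR[X]),
  iot Apol ^ N * F = Gpol * H + iot r0 + iot r1 * C y1

lemma Red_iot (r : RR[X]) : Red (iot r) := ⟨0, 0, r, 0, by simp⟩

lemma Red_add {F F' : RR[X][X]} (h : Red F) (h' : Red F') : Red (F + F') := by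
  obtain ⟨N, H, r0, r1, e⟩ := h
  obtain ⟨N', H', r0', r1', e'⟩ := h'
  refine ⟨N + N', iot Apol ^ N' * H + iot Apol ^ N * H', Apol ^ N' * r0 + Apol ^ N * r0',
    Apol ^ N' * r1 + Apol ^ N * r1', ?_⟩
  simp only [map_add, map_mul, map_pow]
  linear_combination iot Apol ^ N' * e + iot Apol ^ N * e'

lemma Red_mul (r : RR[X]) {F : RR[X][X]} (h : Red F) : Red (iot r * F) := by
  obtain ⟨N, H, r0, r1, e⟩ := h
  refine ⟨N, iot r * H, r * r0, r * r1, ?_⟩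
  simp only [map_mul]
  linear_combination iot r * e

lemma Red_y {F : RR[X][X]} (h : Red F) : Red (C y1 * F) := by
  obtain ⟨N, H, r0, r1, e⟩ := h
  refine ⟨N + 1, iot Apol * C y1 * H + iot r1, - (r1 * e0pol), Apol * r0 - r1 * e1pol, ?_⟩
  simp only [map_mul, map_neg, map_sub, Gpol] at e ⊢
  linear_combination (iot Apol * C y1) * e

lemma Red_all (F : RR[X][X]) : Red F := by
  have hY : ∀ F, Red F → Red (C X * F) := by
    intro F h
    have := Red_add (Red_y h) (Red_mul (C γ24) h)
    convert this using 1
    simp only [y1, map_sub, iot_C]; ring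
  have hC : ∀ p : RR[X], Red (C p) := by
    intro p
    induction p using Polynomial.induction_on with
    | C a => rw [← iot_C]; exact Red_iot _
    | add p q hp hq => rw [C_add]; exact Red_add hp hq
    | monomial n a h =>
      have := hY _ h
      convert this using 1
      simp only [map_mul, map_pow]; ring
  induction F using Polynomial.induction_on with
  | C a => exact hC a
  | add p q hp hq => exact Red_add hp hq
  | monomial n a h =>
    have := Red_mul X h
    convert this using 1
    simp only [iot_X]; ring

/-- no monomial divisible by x²y² -/
def Thin (F : RR[X][X]) : Prop := ∀ i j, 2 ≤ i → 2 ≤ j → (F.coeff i).coeff j = 0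

lemma indep_even (F : RR[X][X]) (hF : Thin F)
    (h : ∀ ρ, evT (qp ρ) (tr2 0 2 ρ) (tr2 1 3 ρ) F = 0) : F = 0 := by
  obtain ⟨N, H, r0, r1, e⟩ := Red_all F
  have hr := indep_x (r0 - C γ24 * r1) r1 (by
    intro ρ
    have := congrArg (evT (qp ρ) (tr2 0 2 ρ) (tr2 1 3 ρ)) e
    simp only [map_mul, map_add, map_pow, h ρ, ev_G, evT_iot, evT_C, ev_y1, ← ev24] at this
    simp only [map_sub, map_mul, evp_C]
    linear_combination - this)
  obtain ⟨h0, rfl⟩ := hr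
  obtain rfl : r0 = 0 := by simpa using h0
  simp only [map_zero, zero_mul, add_zero] at e
  by_contra hne
  have lc := congrArg leadingCoeff e
  have mA : (iot Apol ^ N).Monic := (A_monic.1.map C).pow N
  rw [leadingCoeff_mul, leadingCoeff_mul, mA.leadingCoeff, one_mul, G_lc] at lc
  have hlc : F.leadingCoeff ≠ 0 := leadingCoeff_ne_zero.2 hne
  have hH : H.leadingCoeff ≠ 0 := by
    intro h0; rw [h0, mul_zero] at lc; exact hlc lc
  have hd : 2 ≤ F.leadingCoeff.natDegree := by
    rw [lc, natDegree_mul g2_monic.1.ne_zero hH, g2_monic.2]; omega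
  have hn : F.natDegree ≤ 1 := by
    by_contra hc
    have := hF F.natDegree _ (by omega) hd
    exact hlc (leadingCoeff_eq_zero.1 this)
  have hFe := eq_X_add_C_of_natDegree_le_one hn
  have := indep_y (F.coeff 0) (F.coeff 1) (by
    intro ρ
    have := h ρ
    rw [hFe] at this
    simp only [map_add, map_mul, evT_C, evT_X] at this
    linear_combination this)
  rw [this.1, this.2] at hFe
  apply hne
  rw [hFe]; simp

end Indep2
section Indep3

open Polynomial

noncomputable def p11 : RR[X] := C (β11 * β22 * β33 - β11 * β23 ^ 2 - β33 * β12 ^ 2)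
  + C (2 * β12 * β23) * x1 - C β22 * x1 ^ 2
noncomputable def u12 : RR[X] := C (β11 * β23 * β34 + β12 * β33 * β14)
  - C (β12 * β34 + β23 * β14) * x1
noncomputable def k1 : RR[X] := C β12 * y1 - C (β22 * β14)
noncomputable def k0 : RR[X] := C β11 * (C (β22 * β34) - C β23 * y1)
  - C (β12 * (β12 * β34 - β23 * β14))
noncomputable def l1 : RR[X] := C β23 * y1 - C (β22 * β34)
noncomputable def l0 : RR[X] := C (β12 * β23 * β34) - C (β12 * β33) * y1 + C (β22 * β33 * β14)
  - C (β23 * β23 * β14)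
/-- Gram determinant of 1,2,4 -/
noncomputable def m11 : RR[X] := C (β11 * β22 * β44 - β22 * β14 ^ 2 - β44 * β12 ^ 2)
  + C (2 * β12 * β14) * y1 - C β11 * y1 ^ 2
noncomputable def n12 : RR[X] := C (β12 * β23 * β44 + β22 * β34 * β14)
  - C (β12 * β34 + β23 * β14) * y1

lemma ev_p11 (ρ) : evp (qp ρ) (tr2 0 2 ρ) p11 = -2 * (sf 0 1 2 ρ * sf 0 1 2 ρ) := by
  simp only [p11, map_add, map_sub, map_mul, map_pow, evp_C, ev_x1, ev11, ev22, ev33, ev12, ev23,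
    map_ofNat, bf_apply, sf_apply]
  ring

lemma ev_q12 (ρ) : evp (qp ρ) (tr2 0 2 ρ) u12 + evp (qp ρ) (tr2 0 2 ρ) Apol * bf 1 3 ρ
    = -2 * (sf 0 2 3 ρ * sf 0 1 2 ρ) := by
  simp only [u12, Apol, map_add, map_sub, map_mul, map_pow, evp_C, ev_x1, ev11, ev33, ev12, ev23,
    ev34, ev14, bf_apply, sf_apply]
  ring

lemma ev_k (ρ) : evp (qp ρ) (tr2 1 3 ρ) k0 + evp (qp ρ) (tr2 1 3 ρ) k1 * bf 0 2 ρ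
    = -2 * (sf 0 1 3 ρ * sf 0 1 2 ρ) := by
  simp only [k0, k1, map_sub, map_mul, evp_C, ev_y1, ev11, ev22, ev12, ev23,
    ev34, ev14, bf_apply, sf_apply]
  ring

lemma ev_l (ρ) : evp (qp ρ) (tr2 1 3 ρ) l0 + evp (qp ρ) (tr2 1 3 ρ) l1 * bf 0 2 ρ
    = -2 * (sf 1 2 3 ρ * sf 0 1 2 ρ) := by
  simp only [l0, l1, map_add, map_sub, map_mul, evp_C, ev_y1, ev22, ev33, ev12, ev23,
    ev34, ev14, bf_apply, sf_apply]
  ring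

lemma ev_m11 (ρ) : evp (qp ρ) (tr2 1 3 ρ) m11 = -2 * (sf 0 1 3 ρ * sf 0 1 3 ρ) := by
  simp only [m11, map_add, map_sub, map_mul, map_pow, evp_C, ev_y1, ev11, ev22, ev44, ev12, ev14,
    map_ofNat, bf_apply, sf_apply]
  ring

lemma ev_n12 (ρ) : evp (qp ρ) (tr2 1 3 ρ) n12 + evp (qp ρ) (tr2 1 3 ρ) g2pol * bf 0 2 ρ
    = -2 * (sf 1 2 3 ρ * sf 0 1 3 ρ) := by
  simp only [n12, g2pol, map_add, map_sub, map_mul, map_pow, evp_C, ev_y1, ev22, ev44, ev12, ev23,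
    ev34, ev14, bf_apply, sf_apply]
  ring

lemma β22_ne : β22 ≠ 0 := by
  intro h
  have := congrArg (MvPolynomial.eval 0) h
  simp [β22] at this

lemma p11_deg : p11.natDegree = 2 := by
  have : p11 = C (- β22) * X ^ 2 + C (2 * β12 * β23 + 2 * β22 * γ13) * X
      + C (β11 * β22 * β33 - β11 * β23 ^ 2 - β33 * β12 ^ 2 - 2 * β12 * β23 * γ13
        - β22 * γ13 ^ 2) := by
    simp only [p11, x1, map_add, map_sub, map_mul, map_pow, map_neg, map_ofNat]
    ring
  rw [this]
  exact natDegree_quadratic (neg_ne_zero.2 β22_ne)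

lemma m11_ne : m11 ≠ 0 := by
  intro h
  have := congrArg (evp 0 0) h
  simp [m11, y1, β22, β11, β44, β12, β14, γ24] at this

lemma mul_deg {a p : RR[X]} (hp : p.natDegree = 2) (h : ∀ i, 2 ≤ i → (a * p).coeff i = 0) :
    a = 0 := by
  by_contra ha
  have hp0 : p ≠ 0 := by rintro rfl; simp at hp
  have hd := natDegree_mul ha hp0
  have := h (a * p).natDegree (by omega)
  exact mul_ne_zero ha hp0 (leadingCoeff_eq_zero.1 this)

lemma indep_odd (a b c d : RR[X])
    (h : ∀ ρ, evp (qp ρ) (tr2 0 2 ρ) a * sf 0 1 2 ρ + evp (qp ρ) (tr2 0 2 ρ) b * sf 0 2 3 ρ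
      + evp (qp ρ) (tr2 1 3 ρ) c * sf 0 1 3 ρ + evp (qp ρ) (tr2 1 3 ρ) d * sf 1 2 3 ρ = 0) :
    a = 0 ∧ b = 0 ∧ c = 0 ∧ d = 0 := by
  set U : RR[X] := a * p11 + b * u12 with hU
  set V : RR[X] := b * Apol with hV
  set W : RR[X] := c * k1 + d * l1 with hW
  set Z : RR[X] := c * k0 + d * l0 with hZ
  set F : RR[X][X] := iot U + iot V * C y1 + C W * (X + C (C (-γ13))) + C Z with hF
  have co : ∀ i, 2 ≤ i → F.coeff i = C (U.coeff i) + C (V.coeff i) * y1 := by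
    intro i hi
    obtain ⟨i, rfl⟩ := Nat.exists_eq_add_of_le' hi
    have e1 : (C Z : RR[X][X]).coeff (i + 2) = 0 := coeff_C_succ
    have e2 : (C W * (X + C (C (-γ13))) : RR[X][X]).coeff (i + 2) = 0 := by
      rw [coeff_C_mul, coeff_add, coeff_X, coeff_C_succ]
      simp
    rw [hF, coeff_add, coeff_add, coeff_add, e1, e2, coeff_mul_C, iot_coeff, iot_coeff]
    simp
  have thin : Thin F := by
    intro i j hi hj
    obtain ⟨j, rfl⟩ := Nat.exists_eq_add_of_le' hj
    rw [co i hi, coeff_add, coeff_C_mul, y1, coeff_sub, coeff_X, coeff_C_succ, coeff_C_succ]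
    simp
  have F0 : F = 0 := by
    apply indep_even F thin
    intro ρ
    have e1 := ev_p11 ρ
    have e2 := ev_q12 ρ
    have e3 := ev_k ρ
    have e4 := ev_l ρ
    have e5 : evT (qp ρ) (tr2 0 2 ρ) (tr2 1 3 ρ) (X + C (C (-γ13))) = bf 0 2 ρ := by
      rw [← ev13, map_add, evT_X, evT_C, evp_C, map_neg, sub_eq_add_neg]
    simp only [hF, hU, hV, hW, hZ, map_add, map_mul, evT_iot, evT_C, e5, ev_y1]
    linear_combination evp (qp ρ) (tr2 0 2 ρ) a * e1 + evp (qp ρ) (tr2 0 2 ρ) b * e2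
      + evp (qp ρ) (tr2 1 3 ρ) c * e3 + evp (qp ρ) (tr2 1 3 ρ) d * e4
      - 2 * sf 0 1 2 ρ * h ρ
  have UV : ∀ i, 2 ≤ i → U.coeff i = 0 ∧ V.coeff i = 0 := by
    intro i hi
    have h1 := co i hi
    rw [F0, coeff_zero] at h1
    have h2 := congrArg (fun p => p.coeff 1) h1
    have h3 := congrArg (fun p => p.coeff 0) h1
    have hv : V.coeff i = 0 := by
      simpa [y1, coeff_C, coeff_X] using h2.symm
    refine ⟨?_, hv⟩
    simpa [hv] using h3.symm
  have hb : b = 0 := mul_deg A_monic.2 fun i hi => (UV i hi).2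
  have ha : a = 0 := mul_deg p11_deg fun i hi => by simpa [hU, hb] using (UV i hi).1
  subst ha hb
  have hcd := indep_y (c * m11 + d * n12 - d * g2pol * C γ13) (d * g2pol) (by
    intro ρ
    have e1 := ev_m11 ρ
    have e2 := ev_n12 ρ
    have hh := h ρ
    simp only [map_zero, zero_mul, zero_add] at hh
    simp only [map_add, map_sub, map_mul, evp_C]
    rw [← ev13] at e2
    linear_combination evp (qp ρ) (tr2 1 3 ρ) c * e1 + evp (qp ρ) (tr2 1 3 ρ) d * e2
      - 2 * sf 0 1 3 ρ * hh)
  have hd : d = 0 := (mul_eq_zero.1 hcd.2).resolve_right g2_monic.1.ne_zero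
  subst hd
  have hc : c = 0 := by
    have := hcd.1
    simp only [zero_mul, add_zero, sub_zero] at this
    exact (mul_eq_zero.1 this).resolve_right m11_ne
  exact ⟨rfl, rfl, hc, rfl⟩

/-- transposed quadruple -/
noncomputable def tp (ρ : Fin 4 → SL2) : Fin 4 → SL2 := fun i => (ρ i).transpose

lemma tp_tr1 (ρ i) : tr1 i (tp ρ) = tr1 i ρ := by
  simp [tr1, tp]

lemma tp_tr2 (ρ i j) : tr2 i j (tp ρ) = tr2 i j ρ := by
  simp [tr2, tp, Matrix.trace, Fin.sum_univ_two, Matrix.mul_apply]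
  ring

lemma tp_tr3 (ρ i j k) : tr3 i j k (tp ρ) = tr3 k j i ρ := by
  simp [tr3, tp, Matrix.trace, Fin.sum_univ_two, Matrix.mul_apply]
  ring

lemma tp_qp (ρ) : qp (tp ρ) = qp ρ := by
  funext i
  fin_cases i <;> simp [qp, qv, tp_tr1, tp_tr2]

lemma indep_all (F : RR[X][X]) (hF : Thin F) (a b c d : RR[X])
    (h : ∀ ρ, evT (qp ρ) (tr2 0 2 ρ) (tr2 1 3 ρ) F
      + evp (qp ρ) (tr2 0 2 ρ) a * tr3 0 1 2 ρ + evp (qp ρ) (tr2 0 2 ρ) b * tr3 0 2 3 ρ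
      + evp (qp ρ) (tr2 1 3 ρ) c * tr3 0 1 3 ρ + evp (qp ρ) (tr2 1 3 ρ) d * tr3 1 2 3 ρ = 0) :
    F = 0 ∧ a = 0 ∧ b = 0 ∧ c = 0 ∧ d = 0 := by
  have ho := indep_odd a b c d (by
    intro ρ
    have h1 := h ρ
    have h2 := h (tp ρ)
    simp only [tp_qp, tp_tr2, tp_tr3] at h2
    simp only [sf, Pi.smul_apply, Pi.sub_apply, smul_eq_mul]
    linear_combination (h1 - h2) / 2)
  obtain ⟨rfl, rfl, rfl, rfl⟩ := ho
  refine ⟨indep_even F hF fun ρ => by simpa using h ρ, rfl, rfl, rfl, rfl⟩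

/-- index type of the basis -/
abbrev Idx : Type := {p : ℕ × ℕ // p.1 < 2 ∨ p.2 < 2} ⊕ (ℕ ⊕ ℕ) ⊕ (ℕ ⊕ ℕ)

/-- the basis as a family -/
noncomputable def bas : Idx → Fn
  | .inl p => tr2 0 2 ^ p.1.1 * tr2 1 3 ^ p.1.2
  | .inr (.inl (.inl k)) => tr2 0 2 ^ k * tr3 0 1 2
  | .inr (.inl (.inr k)) => tr2 0 2 ^ k * tr3 0 2 3
  | .inr (.inr (.inl k)) => tr2 1 3 ^ k * tr3 0 1 3
  | .inr (.inr (.inr k)) => tr2 1 3 ^ k * tr3 1 2 3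

lemma A_range : Aset ⊆ Set.range bas := by
  rintro f (((rfl | rfl | rfl | rfl) | ⟨k, -, rfl | rfl | rfl | rfl⟩) |
    ⟨k, rfl | rfl | rfl | rfl⟩)
  · exact ⟨.inl ⟨(0, 0), by simp⟩, by simp [bas]⟩
  · exact ⟨.inl ⟨(1, 0), by simp⟩, by simp [bas]⟩
  · exact ⟨.inl ⟨(0, 1), by simp⟩, by simp [bas]⟩
  · exact ⟨.inl ⟨(1, 1), by simp⟩, by simp [bas]⟩
  · exact ⟨.inl ⟨(k, 0), by simp⟩, by simp [bas]⟩
  · exact ⟨.inl ⟨(k, 1), by simp⟩, by simp [bas]⟩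
  · exact ⟨.inl ⟨(0, k), by simp⟩, by simp [bas]⟩
  · exact ⟨.inl ⟨(1, k), by simp⟩, by simp [bas, mul_comm]⟩
  · exact ⟨.inr (.inl (.inl k)), rfl⟩
  · exact ⟨.inr (.inl (.inr k)), rfl⟩
  · exact ⟨.inr (.inr (.inl k)), rfl⟩
  · exact ⟨.inr (.inr (.inr k)), rfl⟩

lemma Q_lift (c : Fn) (hc : c ∈ Qalg) : ∃ r : RR, ∀ ρ, MvPolynomial.eval (qp ρ) r = c ρ := by
  induction hc using Algebra.adjoin_induction with
  | mem f hf =>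
    have : ∃ i, f = qv i := by
      rcases hf with rfl | rfl | rfl | rfl | rfl | rfl | rfl | rfl
      exacts [⟨0, rfl⟩, ⟨1, rfl⟩, ⟨2, rfl⟩, ⟨3, rfl⟩, ⟨4, rfl⟩, ⟨5, rfl⟩, ⟨6, rfl⟩, ⟨7, rfl⟩]
    obtain ⟨i, rfl⟩ := this
    exact ⟨MvPolynomial.X i, fun ρ => by simp [qp]⟩
  | algebraMap r => exact ⟨MvPolynomial.C r, fun ρ => by simp⟩
  | add f g _ _ hf hg =>
    obtain ⟨r, hr⟩ := hf
    obtain ⟨s, hs⟩ := hg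
    exact ⟨r + s, fun ρ => by simp [hr, hs]⟩
  | mul f g _ _ hf hg =>
    obtain ⟨r, hr⟩ := hf
    obtain ⟨s, hs⟩ := hg
    exact ⟨r * s, fun ρ => by simp [hr, hs]⟩

/-- the part of a term which is a polynomial in both variables -/
noncomputable def mF : Idx → RR → RR[X][X]
  | .inl p, r => monomial p.1.1 (monomial p.1.2 r)
  | .inr _, _ => 0
noncomputable def ma : Idx → RR → RR[X]
  | .inr (.inl (.inl k)), r => monomial k r
  | _, _ => 0
noncomputable def mb : Idx → RR → RR[X]
  | .inr (.inl (.inr k)), r => monomial k r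
  | _, _ => 0
noncomputable def mc : Idx → RR → RR[X]
  | .inr (.inr (.inl k)), r => monomial k r
  | _, _ => 0
noncomputable def md : Idx → RR → RR[X]
  | .inr (.inr (.inr k)), r => monomial k r
  | _, _ => 0

lemma evp_mon (q x k) (r : RR) : evp q x (monomial k r) = MvPolynomial.eval q r * x ^ k := by
  simp [evp]

lemma evT_mon (q x y k) (r : RR[X]) : evT q x y (monomial k r) = evp q y r * x ^ k := by
  simp [evT]

lemma ev_term (ρ : Fin 4 → SL2) (i : Idx) (r : RR) :
    evT (qp ρ) (tr2 0 2 ρ) (tr2 1 3 ρ) (mF i r)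
      + evp (qp ρ) (tr2 0 2 ρ) (ma i r) * tr3 0 1 2 ρ
      + evp (qp ρ) (tr2 0 2 ρ) (mb i r) * tr3 0 2 3 ρ
      + evp (qp ρ) (tr2 1 3 ρ) (mc i r) * tr3 0 1 3 ρ
      + evp (qp ρ) (tr2 1 3 ρ) (md i r) * tr3 1 2 3 ρ = MvPolynomial.eval (qp ρ) r * bas i ρ := by
  rcases i with p | (k | k) | (k | k) <;>
    simp only [mF, ma, mb, mc, md, evp_mon, evT_mon, map_zero, bas, Pi.mul_apply, Pi.pow_apply] <;>
    ring

lemma mF_coeff (i : Idx) (r : RR) (p) :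
    ((mF i r).coeff p.1.1).coeff p.1.2 = if i = .inl p then r else 0 := by
  rcases i with ⟨⟨m, n⟩, h⟩ | i
  · obtain ⟨⟨m', n'⟩, h'⟩ := p
    simp only [mF, coeff_monomial, Sum.inl.injEq, Subtype.mk.injEq, Prod.mk.injEq]
    by_cases h1 : m = m' <;> simp [h1, coeff_monomial]
  · simp [mF]

lemma mF_thin (i : Idx) (r : RR) : Thin (mF i r) := by
  intro a b ha hb
  rcases i with ⟨⟨m, n⟩, h⟩ | i
  · simp only [mF, coeff_monomial]
    by_cases h1 : m = a
    · have h2 : n ≠ b := by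
        simp only at h
        omega
      simp [h1, coeff_monomial, h2]
    · simp [h1]
  · simp [mF]

lemma ma_coeff (i : Idx) (r : RR) (k) :
    (ma i r).coeff k = if i = .inr (.inl (.inl k)) then r else 0 := by
  rcases i with p | (m | m) | (m | m) <;> simp [ma, coeff_monomial]
lemma mb_coeff (i : Idx) (r : RR) (k) :
    (mb i r).coeff k = if i = .inr (.inl (.inr k)) then r else 0 := by
  rcases i with p | (m | m) | (m | m) <;> simp [mb, coeff_monomial]
lemma mc_coeff (i : Idx) (r : RR) (k) :
    (mc i r).coeff k = if i = .inr (.inr (.inl k)) then r else 0 := by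
  rcases i with p | (m | m) | (m | m) <;> simp [mc, coeff_monomial]
lemma md_coeff (i : Idx) (r : RR) (k) :
    (md i r).coeff k = if i = .inr (.inr (.inr k)) then r else 0 := by
  rcases i with p | (m | m) | (m | m) <;> simp [md, coeff_monomial]

lemma bas_indep : LinearIndependent Qalg bas := by
  rw [linearIndependent_iff]
  intro l hl
  choose lift hlift using fun c : Qalg => Q_lift c.1 c.2
  classical
  -- the coefficient polynomials
  set s := l.support with hs
  set g : Idx → RR := fun i => if i ∈ s then lift (l i) else 0 with hg
  have key : ∀ i, g i = 0 := by
    have zer : ∀ ρ, ∑ i ∈ s, MvPolynomial.eval (qp ρ) (g i) * bas i ρ = 0 := by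
      intro ρ
      have h1 := congrFun hl ρ
      rw [Finsupp.linearCombination_apply, Finsupp.sum, Finset.sum_apply] at h1
      rw [Pi.zero_apply] at h1
      rw [← h1]
      refine Finset.sum_congr rfl fun i hi => ?_
      have h3 : g i = lift (l i) := if_pos hi
      rw [h3, hlift]
      rfl
    have thin : Thin (∑ i ∈ s, mF i (g i)) := by
      intro m n hm hn
      rw [finsetSum_coeff, finsetSum_coeff]
      exact Finset.sum_eq_zero fun i _ => mF_thin i _ m n hm hn
    have main := indep_all (∑ i ∈ s, mF i (g i)) thin (∑ i ∈ s, ma i (g i))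
      (∑ i ∈ s, mb i (g i)) (∑ i ∈ s, mc i (g i)) (∑ i ∈ s, md i (g i)) (by
        intro ρ
        rw [map_sum, map_sum, map_sum, map_sum, map_sum]
        rw [Finset.sum_mul, Finset.sum_mul, Finset.sum_mul, Finset.sum_mul,
          ← Finset.sum_add_distrib, ← Finset.sum_add_distrib, ← Finset.sum_add_distrib,
          ← Finset.sum_add_distrib, ← zer ρ]
        exact Finset.sum_congr rfl fun i _ => ev_term ρ i (g i))
    obtain ⟨hF, ha, hb, hc, hd⟩ := main
    have pick : ∀ j, (∑ i ∈ s, if i = j then g i else 0) = 0 → g j = 0 := by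
      intro j hj
      by_cases hjs : j ∈ s
      · simpa [Finset.sum_ite_eq', hjs] using hj
      · simp [hg, hjs]
    rintro (p | (k | k) | (k | k)) <;> apply pick
    · have h2 := congrArg (fun P => (P.coeff p.1.1).coeff p.1.2) hF
      simpa only [finsetSum_coeff, mF_coeff, coeff_zero] using h2
    · have h2 := congrArg (fun P => P.coeff k) ha
      simpa only [finsetSum_coeff, ma_coeff, coeff_zero] using h2
    · have h2 := congrArg (fun P => P.coeff k) hb
      simpa only [finsetSum_coeff, mb_coeff, coeff_zero] using h2
    · have h2 := congrArg (fun P => P.coeff k) hc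
      simpa only [finsetSum_coeff, mc_coeff, coeff_zero] using h2
    · have h2 := congrArg (fun P => P.coeff k) hd
      simpa only [finsetSum_coeff, md_coeff, coeff_zero] using h2
  ext1 i
  by_cases hi : i ∈ s
  · have := key i
    simp only [hg, hi, if_true] at this
    apply Subtype.ext
    funext ρ
    have h2 := hlift (l i) ρ
    rw [this] at h2
    simpa using h2.symm
  · simpa [hs] using hi

end Indep3

/-- `X` is a free `Q`-module with basis `A`: the elements of `A` lie in `X`,
they are linearly independent over `Q`, and they span `X` over `Q`. -/
theorem stmt_5 :
    (Aset ⊆ (Xalg : Set ((Fin 4 → SL2) → ℂ))) ∧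
    LinearIndependent Qalg ((↑) : Aset → ((Fin 4 → SL2) → ℂ)) ∧
    ∀ f ∈ Xalg, f ∈ Submodule.span Qalg Aset := by
  refine ⟨A_sub, ?_, X_span⟩
  exact (bas_indep.linearIndepOn_id).mono A_range
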